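/- Let {X(s)}_{s≥0} be a centered, sample-path continuous Gaussian process with covariance kernel R(s,t) satisfying assumption (i) (self-similarity of the kernel with exponent ρ > 0). Suppose moreover that for every sufficiently large α > 1, setting t_n = α^n and γ_n = Var(X(t_{n+1}) − X(t_n)), one has P( X(t_{n+1}) − X(t_n) > (2 γ_n log log t_{n+1})^{1/2} for infinitely many n ) = 1. Then almost surely limsup_{s→∞} X(s)/√(2 s^{2ρ} log log s) ≥ σ, where σ = R(1,1)^{1/2}. -/

import Mathlib

open MeasureTheory ProbabilityTheory Filter Asymptotics

noncomputable section

/-- A centered Gaussian process on `[0,∞)`: every finite linear combination of the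
values of the process at nonnegative times has a centered Gaussian distribution. -/
def IsCenteredGaussianProcess {Ω : Type*} [MeasurableSpace Ω] (P : Measure Ω)
    (X : ℝ → Ω → ℝ) : Prop :=
  (∀ s : ℝ, Measurable (X s)) ∧
    ∀ (k : ℕ) (t : Fin k → ℝ) (c : Fin k → ℝ), (∀ i, 0 ≤ t i) →
      ∃ v : NNReal,
        Measure.map (fun ω => ∑ i, c i * X (t i) ω) P = gaussianReal 0 v

open scoped ENNReal Topology

/-- Fernique's tail bound, uniform over all centered Gaussian measures on spaces `Fin k → ℝ`
giving mass at least `3 / 4` to the ball of radius `a`. -/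
lemma exists_gaussian_norm_tail_bound {a : ℝ} (ha : 0 < a) :
    ∃ C > (0 : ℝ), ∃ K : ℝ≥0∞, K ≠ ∞ ∧ ∀ (k : ℕ) (μ : Measure (Fin k → ℝ)) [IsGaussian μ],
      (∀ L : StrongDual ℝ (Fin k → ℝ), μ[L] = 0) → 3 / 4 ≤ μ {x | ‖x‖ ≤ a} →
      ∀ r : ℝ, 0 ≤ r → μ {x | r < ‖x‖} ≤ K * ENNReal.ofReal (Real.exp (-(C * r ^ 2))) := by
  have hc_real : (3 / 4 : ℝ≥0∞) = ENNReal.ofReal (3 / 4) := by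
    rw [ENNReal.ofReal_div_of_pos (by norm_num)]; simp
  have hc_gt : (2 : ℝ≥0∞)⁻¹ < 3 / 4 := by
    rw [hc_real, show (2 : ℝ≥0∞)⁻¹ = ENNReal.ofReal (1 / 2) by simp]
    exact (ENNReal.ofReal_lt_ofReal_iff (by norm_num)).2 (by norm_num)
  have hc_lt : (3 / 4 : ℝ≥0∞) < 1 := by
    rw [hc_real]; exact ENNReal.ofReal_lt_one.2 (by norm_num)
  have hratio : (3 / 4 / (1 - 3 / 4) : ℝ≥0∞).toReal = 3 := by
    rw [hc_real, show (1 : ℝ≥0∞) = ENNReal.ofReal 1 by simp,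
      ← ENNReal.ofReal_sub _ (by norm_num), ENNReal.toReal_div,
      ENNReal.toReal_ofReal (by norm_num), ENNReal.toReal_ofReal (by norm_num)]
    norm_num
  have hC : 0 < Fernique.logRatio (3 / 4) * a⁻¹ ^ 2 :=
    mul_pos (Fernique.logRatio_pos hc_gt hc_lt) (by positivity)
  refine ⟨_, hC, ENNReal.ofReal (Real.exp (Fernique.logRatio (3 / 4)))
      + ∑' n : ℕ, ENNReal.ofReal (Real.exp
        (-2⁻¹ * Real.log (3 / 4 / (1 - 3 / 4) : ℝ≥0∞).toReal * 2 ^ n)), ?_, ?_⟩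
  · refine ENNReal.add_ne_top.2 ⟨ENNReal.ofReal_ne_top, (Summable.tsum_ofReal_lt_top <|
      Real.summable_exp_nat_mul_of_ge ?_ (fun i ↦ mod_cast (Nat.lt_pow_self (by simp)).le)).ne⟩
    rw [hratio]
    exact mul_neg_of_neg_of_pos (by simp) (Real.log_pos (by norm_num))
  · intro k μ _ hμ hc r hr
    have hint := lintegral_exp_mul_sq_norm_le_of_map_rotation_eq_self
      (IsGaussian.map_rotation_eq_self_of_forall_strongDual_eq_zero hμ _) hc hc_gt
    set C := Fernique.logRatio (3 / 4) * a⁻¹ ^ 2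
    have hmarkov := meas_ge_le_lintegral_div (μ := μ)
      (f := fun x => ENNReal.ofReal (Real.exp (C * ‖x‖ ^ 2)))
      (by fun_prop) (ε := ENNReal.ofReal (Real.exp (C * r ^ 2)))
      (by simp [Real.exp_pos]) (by simp)
    rw [Real.exp_neg, ENNReal.ofReal_inv_of_pos (Real.exp_pos _), ← div_eq_mul_inv]
    refine le_trans (measure_mono fun x hx => ?_) (hmarkov.trans (ENNReal.div_le_div_right hint _))
    simp only [Set.mem_ofPred_eq] at hx ⊢
    gcongr

section GaussianProcess

variable {Ω : Type*} [MeasurableSpace Ω] {P : Measure Ω} {X : ℝ → Ω → ℝ} {R : ℝ → ℝ → ℝ}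

lemma IsCenteredGaussianProcess.memLp_two (hGauss : IsCenteredGaussianProcess P X) {t : ℝ}
    (ht : 0 ≤ t) : MemLp (X t) 2 P := by
  obtain ⟨v, hv⟩ := hGauss.2 1 (fun _ => t) (fun _ => 1) (fun _ => ht)
  simp only [Finset.univ_unique, one_mul, Finset.sum_const, Finset.card_singleton, one_smul] at hv
  have h : MemLp id 2 (Measure.map (X t) P) := by
    rw [hv]; exact memLp_id_gaussianReal 2
  exact (memLp_map_measure_iff (by fun_prop) (hGauss.1 t).aemeasurable).1 h

/-- The law of a linear combination of values of a centered Gaussian process, in terms of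
its covariance kernel. -/
lemma IsCenteredGaussianProcess.map_sum_eq (hGauss : IsCenteredGaussianProcess P X)
    (hR : ∀ s t : ℝ, 0 ≤ s → 0 ≤ t → R s t = ∫ ω, X s ω * X t ω ∂P)
    {k : ℕ} (t c : Fin k → ℝ) (ht : ∀ i, 0 ≤ t i) :
    Measure.map (fun ω => ∑ i, c i * X (t i) ω) P
        = gaussianReal 0 (∑ i, ∑ j, c i * c j * R (t i) (t j)).toNNReal ∧
      variance (fun ω => ∑ i, c i * X (t i) ω) P = ∑ i, ∑ j, c i * c j * R (t i) (t j) := by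
  obtain ⟨v, hv⟩ := hGauss.2 k t c ht
  have hmeas : Measurable fun ω => ∑ i, c i * X (t i) ω :=
    Finset.measurable_sum _ fun i _ => (hGauss.1 (t i)).const_mul _
  have hmean : ∫ ω, ∑ i, c i * X (t i) ω ∂P = 0 := by
    rw [← integral_map (f := fun x : ℝ => x) hmeas.aemeasurable (by fun_prop), hv,
      integral_id_gaussianReal]
  have hvar : variance (fun ω => ∑ i, c i * X (t i) ω) P = v := by
    rw [← variance_id_gaussianReal (μ := 0) (v := v), ← hv,
      variance_map (by fun_prop) hmeas.aemeasurable]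
    rfl
  have hint : ∀ i j, Integrable (fun ω => X (t i) ω * X (t j) ω) P := fun i j =>
    (hGauss.memLp_two (ht i)).integrable_mul (hGauss.memLp_two (ht j))
  have hsum : variance (fun ω => ∑ i, c i * X (t i) ω) P
      = ∑ i, ∑ j, c i * c j * R (t i) (t j) := by
    rw [variance_of_integral_eq_zero hmeas.aemeasurable hmean]
    have hsq : ∀ ω, (∑ i, c i * X (t i) ω) ^ 2
        = ∑ i, ∑ j, c i * c j * (X (t i) ω * X (t j) ω) := fun ω => by
      rw [sq, Finset.sum_mul_sum]
      exact Finset.sum_congr rfl fun i _ => Finset.sum_congr rfl fun j _ => by ring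
    simp_rw [hsq]
    rw [integral_finsetSum _ fun i _ => integrable_finsetSum _ fun j _ => (hint i j).const_mul _]
    refine Finset.sum_congr rfl fun i _ => ?_
    rw [integral_finsetSum _ fun j _ => (hint i j).const_mul _]
    exact Finset.sum_congr rfl fun j _ => by
      rw [integral_const_mul, hR _ _ (ht i) (ht j)]
  refine ⟨?_, hsum⟩
  rw [hv, ← hsum, hvar, Real.toNNReal_coe]

lemma IsCenteredGaussianProcess.map_map_strongDual (hGauss : IsCenteredGaussianProcess P X)
    {k : ℕ} (t : Fin k → ℝ) (b : ℝ) (L : StrongDual ℝ (Fin k → ℝ)) :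
    (P.map fun ω i => b * X (t i) ω).map L
      = P.map fun ω => ∑ i, (b * L (Pi.single i 1)) * X (t i) ω := by
  have hmeas : Measurable fun ω (i : Fin k) => b * X (t i) ω :=
    measurable_pi_lambda _ fun i => (hGauss.1 (t i)).const_mul _
  rw [Measure.map_map (by fun_prop) hmeas]
  congr 1
  ext ω
  simp only [Function.comp_apply]
  rw [← LinearMap.sum_single_apply (fun _ => ℝ) (fun i => b * X (t i) ω), map_sum]
  refine Finset.sum_congr rfl fun i _ => ?_
  rw [show Pi.single i (b * X (t i) ω) = (b * X (t i) ω) • Pi.single i (1 : ℝ) by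
    rw [← Pi.single_smul]; simp, map_smul, smul_eq_mul]
  ring

lemma IsCenteredGaussianProcess.isGaussian_map (hGauss : IsCenteredGaussianProcess P X)
    {k : ℕ} (t : Fin k → ℝ) (ht : ∀ i, 0 ≤ t i) :
    IsGaussian (P.map fun ω i => X (t i) ω) ∧
      ∀ L : StrongDual ℝ (Fin k → ℝ), (P.map fun ω i => X (t i) ω)[L] = 0 := by
  have key : ∀ L : StrongDual ℝ (Fin k → ℝ), ∃ v : NNReal,
      (P.map fun ω i => X (t i) ω).map L = gaussianReal 0 v := fun L => by
    obtain ⟨v, hv⟩ := hGauss.2 k t (fun i => 1 * L (Pi.single i 1)) ht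
    exact ⟨v, by simpa only [one_mul] using (hGauss.map_map_strongDual t 1 L).trans hv⟩
  refine ⟨isGaussian_of_map_eq_gaussianReal fun L => ⟨0, key L⟩, fun L => ?_⟩
  obtain ⟨v, hv⟩ := key L
  rw [← integral_map (f := fun x : ℝ => x) (by fun_prop) (by fun_prop), hv,
    integral_id_gaussianReal]

/-- Self-similarity of the kernel implies self-similarity of the finite-dimensional laws. -/
lemma IsCenteredGaussianProcess.map_scaling_eq [IsProbabilityMeasure P]
    (hGauss : IsCenteredGaussianProcess P X) {ρ : ℝ}
    (hR : ∀ s t : ℝ, 0 ≤ s → 0 ≤ t → R s t = ∫ ω, X s ω * X t ω ∂P)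
    (hss : ∀ c > (0 : ℝ), ∀ s > (0 : ℝ), ∀ t > (0 : ℝ),
      R (c * s) (c * t) = c ^ (2 * ρ) * R s t)
    {k : ℕ} (t : Fin k → ℝ) (ht : ∀ i, 0 < t i) {c : ℝ} (hc : 0 < c) :
    P.map (fun ω i => (c ^ ρ)⁻¹ * X (c * t i) ω) = P.map fun ω i => X (t i) ω := by
  have hX : ∀ (b : ℝ) (s : Fin k → ℝ), Measurable fun ω (i : Fin k) => b * X (s i) ω :=
    fun b s => measurable_pi_lambda _ fun i => (hGauss.1 (s i)).const_mul _
  have := Measure.isProbabilityMeasure_map (μ := P) (hX (c ^ ρ)⁻¹ fun i => c * t i).aemeasurable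
  have := Measure.isProbabilityMeasure_map (μ := P) (hX 1 t).aemeasurable
  suffices h : P.map (fun ω i => (c ^ ρ)⁻¹ * X (c * t i) ω) = P.map fun ω i => 1 * X (t i) ω by
    simpa only [one_mul] using h
  refine Measure.ext_of_charFunDual (funext fun L => ?_)
  rw [charFunDual_eq_charFun_map_one, charFunDual_eq_charFun_map_one,
    hGauss.map_map_strongDual (fun i => c * t i), hGauss.map_map_strongDual t,
    (hGauss.map_sum_eq hR _ _ fun i => (mul_pos hc (ht i)).le).1,
    (hGauss.map_sum_eq hR _ _ fun i => (ht i).le).1]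
  congr 3
  refine Finset.sum_congr rfl fun i _ => Finset.sum_congr rfl fun j _ => ?_
  rw [hss c hc _ (ht i) _ (ht j), two_mul, Real.rpow_add hc]
  have := (Real.rpow_pos_of_pos hc ρ).ne'
  field_simp

/-- The variance of an increment dominates the squared difference of standard deviations. -/
lemma IsCenteredGaussianProcess.le_variance_increment
    (hGauss : IsCenteredGaussianProcess P X) {ρ : ℝ}
    (hR : ∀ s t : ℝ, 0 ≤ s → 0 ≤ t → R s t = ∫ ω, X s ω * X t ω ∂P)
    (hss : ∀ c > (0 : ℝ), ∀ s > (0 : ℝ), ∀ t > (0 : ℝ),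
      R (c * s) (c * t) = c ^ (2 * ρ) * R s t) {s t : ℝ} (hs : 0 < s) (ht : 0 < t) :
    R 1 1 * (t ^ ρ - s ^ ρ) ^ 2 ≤ variance (fun ω => X t ω - X s ω) P := by
  have hdiag : ∀ u > 0, R u u = u ^ ρ * u ^ ρ * R 1 1 := fun u hu => by
    have := hss u hu 1 one_pos 1 one_pos
    rwa [mul_one, two_mul, Real.rpow_add hu] at this
  have hsymm : R s t = R t s := by
    rw [hR _ _ hs.le ht.le, hR _ _ ht.le hs.le]; simp_rw [mul_comm]
  have hquad : ∀ a b : ℝ, variance (fun ω => a * X t ω + b * X s ω) P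
      = a ^ 2 * R t t + 2 * a * b * R t s + b ^ 2 * R s s := fun a b => by
    have := (hGauss.map_sum_eq hR ![t, s] ![a, b]
      (by simp [Fin.forall_fin_two, hs.le, ht.le])).2
    simp only [Fin.sum_univ_two, Matrix.cons_val_zero, Matrix.cons_val_one, hsymm] at this
    rw [this]; ring
  have hCS := variance_nonneg (fun ω => s ^ ρ * X t ω + -t ^ ρ * X s ω) P
  have hvar : variance (fun ω => X t ω - X s ω) P = R t t - 2 * R t s + R s s := by
    have := hquad 1 (-1)
    simp only [one_mul, neg_one_mul, ← sub_eq_add_neg] at this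
    rw [this]; ring
  rw [hquad, hdiag t ht, hdiag s hs] at hCS
  rw [hvar, hdiag t ht, hdiag s hs]
  have hab : 0 < t ^ ρ * s ^ ρ :=
    mul_pos (Real.rpow_pos_of_pos ht ρ) (Real.rpow_pos_of_pos hs ρ)
  have hcov : R t s ≤ t ^ ρ * s ^ ρ * R 1 1 := by
    refine le_of_mul_le_mul_left ?_ hab
    linarith
  linarith

end GaussianProcess

section UpperBound

variable {Ω : Type*} [MeasurableSpace Ω] {P : Measure Ω} {X : ℝ → Ω → ℝ} {R : ℝ → ℝ → ℝ}

instance nonempty_Icc_one_two : Nonempty (Set.Icc (1 : ℝ) 2) := ⟨⟨1, by norm_num⟩⟩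

/-- A dense sequence of times in `[1, 2]`. -/
def denseTime (i : ℕ) : ℝ := TopologicalSpace.denseSeq (Set.Icc (1 : ℝ) 2) i

lemma denseTime_mem (i : ℕ) : denseTime i ∈ Set.Icc (1 : ℝ) 2 :=
  (TopologicalSpace.denseSeq (Set.Icc (1 : ℝ) 2) i).2

lemma denseTime_pos (i : ℕ) : 0 < denseTime i := one_pos.trans_le (denseTime_mem i).1

/-- A bound along `denseTime` extends to `[1, 2]` by continuity. -/
lemma abs_le_of_forall_denseTime {f : ℝ → ℝ} (hf : ContinuousOn f (Set.Icc 1 2)) {r : ℝ}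
    (h : ∀ i, |f (denseTime i)| ≤ r) {s : ℝ} (hs : s ∈ Set.Icc (1 : ℝ) 2) : |f s| ≤ r := by
  have hclosed : IsClosed {x : Set.Icc (1 : ℝ) 2 | |f x| ≤ r} :=
    isClosed_le (continuousOn_iff_continuous_domRestrict.1 hf).abs continuous_const
  have hsub : Set.range (TopologicalSpace.denseSeq (Set.Icc (1 : ℝ) 2))
      ⊆ {x : Set.Icc (1 : ℝ) 2 | |f x| ≤ r} := by
    rintro _ ⟨i, rfl⟩; exact h i
  exact hclosed.closure_subset_iff.2 hsub
    (TopologicalSpace.denseRange_denseSeq (Set.Icc (1 : ℝ) 2) ⟨s, hs⟩)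

/-- With probability at least `3 / 4`, a process with continuous paths is bounded on `[1, 2]` by
some deterministic constant. -/
lemma exists_three_quarters_le_measure_bounded [IsProbabilityMeasure P]
    (hcont : ∀ᵐ ω ∂P, ContinuousOn (fun s : ℝ => X s ω) (Set.Ici (0 : ℝ))) :
    ∃ a > (0 : ℝ), 3 / 4 ≤ P {ω | ∀ i, |X (denseTime i) ω| ≤ a} := by
  have hmono : Monotone fun m : ℕ => {ω | ∀ i, |X (denseTime i) ω| ≤ (m : ℝ) + 1} := by
    intro m n hmn ω hω i
    have : (m : ℝ) ≤ n := mod_cast hmn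
    exact (hω i).trans (by linarith)
  have hfull : P (⋃ m : ℕ, {ω | ∀ i, |X (denseTime i) ω| ≤ (m : ℝ) + 1}) = 1 := by
    rw [← measure_univ (μ := P)]
    refine measure_congr (eventuallyEq_univ.2 ?_)
    filter_upwards [hcont] with ω hω
    obtain ⟨b, hb⟩ := (isCompact_Icc.image_of_continuousOn
      ((hω.mono (show Set.Icc (1 : ℝ) 2 ⊆ Set.Ici 0 from
        fun x hx => zero_le_one.trans hx.1)).abs)).bddAbove
    obtain ⟨m, hm⟩ := exists_nat_ge b
    refine Set.mem_iUnion.2 ⟨m, fun i => ?_⟩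
    have := hb (Set.mem_image_of_mem _ (denseTime_mem i))
    linarith
  have htend := tendsto_measure_iUnion_atTop (μ := P) hmono
  rw [hfull] at htend
  have hlt : (3 / 4 : ℝ≥0∞) < 1 := by
    rw [ENNReal.div_lt_iff (by simp) (by simp)]; norm_num
  obtain ⟨m, hm⟩ := (htend.eventually (lt_mem_nhds hlt)).exists
  exact ⟨m + 1, by positivity, hm.le⟩

/-- Gaussian tail bound for the supremum of a self-similar process over dyadic blocks. -/
lemma IsCenteredGaussianProcess.exists_block_tail_bound [IsProbabilityMeasure P]
    (hGauss : IsCenteredGaussianProcess P X) {ρ : ℝ}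
    (hcont : ∀ᵐ ω ∂P, ContinuousOn (fun s : ℝ => X s ω) (Set.Ici (0 : ℝ)))
    (hR : ∀ s t : ℝ, 0 ≤ s → 0 ≤ t → R s t = ∫ ω, X s ω * X t ω ∂P)
    (hss : ∀ c > (0 : ℝ), ∀ s > (0 : ℝ), ∀ t > (0 : ℝ),
      R (c * s) (c * t) = c ^ (2 * ρ) * R s t) :
    ∃ C > (0 : ℝ), ∃ K : ℝ≥0∞, K ≠ ∞ ∧ ∀ c > (0 : ℝ), ∀ r : ℝ, 0 ≤ r →
      P {ω | ∃ i, r < |(c ^ ρ)⁻¹ * X (c * denseTime i) ω|}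
        ≤ K * ENNReal.ofReal (Real.exp (-(C * r ^ 2))) := by
  obtain ⟨a, ha, hmass⟩ := exists_three_quarters_le_measure_bounded hcont
  obtain ⟨C, hC, K, hK, htail⟩ := exists_gaussian_norm_tail_bound ha
  refine ⟨C, hC, K, hK, fun c hc r hr => ?_⟩
  have hnorm : ∀ {k : ℕ} {x : Fin k → ℝ}, r < ‖x‖ ↔ ∃ i, r < |x i| := fun {k x} => by
    rw [← not_le, pi_norm_le_iff_of_nonneg hr]; simp
  have hunion : {ω | ∃ i, r < |(c ^ ρ)⁻¹ * X (c * denseTime i) ω|}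
      = ⋃ k : ℕ, {ω | ∃ i : Fin k, r < |(c ^ ρ)⁻¹ * X (c * denseTime i) ω|} := by
    ext ω
    simp only [Set.mem_ofPred_eq, Set.mem_iUnion]
    exact ⟨fun ⟨i, hi⟩ => ⟨i + 1, Fin.last i, hi⟩, fun ⟨k, i, hi⟩ => ⟨i, hi⟩⟩
  have hmono : Monotone fun k : ℕ =>
      {ω | ∃ i : Fin k, r < |(c ^ ρ)⁻¹ * X (c * denseTime i) ω|} :=
    fun k l hkl ω ⟨i, hi⟩ => ⟨Fin.castLE hkl i, hi⟩
  rw [hunion, hmono.measure_iUnion]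
  refine iSup_le fun k => ?_
  have hmeas : Measurable fun ω (i : Fin k) => X (denseTime i) ω :=
    measurable_pi_lambda _ fun i => hGauss.1 _
  have hmeas_scaled : Measurable fun ω (i : Fin k) => (c ^ ρ)⁻¹ * X (c * denseTime i) ω :=
    measurable_pi_lambda _ fun i => (hGauss.1 _).const_mul _
  obtain ⟨hG, hcentered⟩ := hGauss.isGaussian_map (fun i : Fin k => denseTime i)
    fun i => (denseTime_pos i).le
  have hbound := htail k _ hcentered (by
    rw [Measure.map_apply hmeas (measurableSet_le (by fun_prop) (by fun_prop))]
    refine hmass.trans (measure_mono fun ω hω => ?_)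
    exact (pi_norm_le_iff_of_nonneg ha.le).2 fun i => hω i) r hr
  rw [← hGauss.map_scaling_eq hR hss (fun i : Fin k => denseTime i)
    (fun i => denseTime_pos i) hc,
    Measure.map_apply hmeas_scaled (measurableSet_lt (by fun_prop) (by fun_prop))] at hbound
  refine le_trans (measure_mono fun ω hω => ?_) hbound
  exact hnorm.2 hω

lemma sqrt_lil_normalization {s : ℝ} (hs : 0 < s) (ρ : ℝ) :
    Real.sqrt (2 * s ^ (2 * ρ) * Real.log (Real.log s))
      = s ^ ρ * Real.sqrt (2 * Real.log (Real.log s)) := by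
  rw [show 2 * s ^ (2 * ρ) * Real.log (Real.log s)
    = (s ^ ρ) ^ 2 * (2 * Real.log (Real.log s)) by
      rw [two_mul ρ, Real.rpow_add hs]; ring,
    Real.sqrt_mul (sq_nonneg _), Real.sqrt_sq (Real.rpow_nonneg hs.le ρ)]

/-- The upper half of the law of the iterated logarithm, up to a constant. -/
lemma IsCenteredGaussianProcess.exists_ae_eventually_abs_le [IsProbabilityMeasure P]
    (hGauss : IsCenteredGaussianProcess P X) {ρ : ℝ} (hρ : 0 < ρ)
    (hcont : ∀ᵐ ω ∂P, ContinuousOn (fun s : ℝ => X s ω) (Set.Ici (0 : ℝ)))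
    (hR : ∀ s t : ℝ, 0 ≤ s → 0 ≤ t → R s t = ∫ ω, X s ω * X t ω ∂P)
    (hss : ∀ c > (0 : ℝ), ∀ s > (0 : ℝ), ∀ t > (0 : ℝ),
      R (c * s) (c * t) = c ^ (2 * ρ) * R s t) :
    ∃ B : ℝ, ∀ᵐ ω ∂P, ∀ᶠ s : ℝ in atTop,
      |X s ω| ≤ B * Real.sqrt (2 * s ^ (2 * ρ) * Real.log (Real.log s)) := by
  obtain ⟨C, hC, K, hK, htail⟩ := hGauss.exists_block_tail_bound hcont hR hss
  set B := (Real.sqrt C)⁻¹ with hB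
  have hB0 : 0 ≤ B := by positivity
  have hCB : C * B ^ 2 = 1 := by
    rw [hB, inv_pow, Real.sq_sqrt hC.le, mul_inv_cancel₀ hC.ne']
  set r : ℕ → ℝ := fun n => B * Real.sqrt (2 * Real.log (Real.log (2 ^ n))) with hr
  have hr0 : ∀ n, 0 ≤ r n := fun n => by positivity
  have hexp : ∀ n, Real.exp (-(C * r n ^ 2)) ≤ Real.exp (-(2 * Real.log (n * Real.log 2))) := by
    intro n
    rw [Real.exp_le_exp, neg_le_neg_iff]
    simp only [hr]
    rw [mul_pow, ← mul_assoc, hCB, one_mul, Real.log_pow]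
    rcases le_total 0 (2 * Real.log (n * Real.log 2)) with h | h
    · rw [Real.sq_sqrt h]
    · exact h.trans (sq_nonneg _)
  have hsummable : Summable fun n : ℕ => Real.exp (-(2 * Real.log (n * Real.log 2))) := by
    rw [← summable_nat_add_iff 1]
    have h := ((summable_nat_add_iff 1).2
      (Real.summable_nat_pow_inv.2 one_lt_two)).mul_right ((Real.log 2 ^ 2)⁻¹)
    refine h.congr fun n => ?_
    have h2 : 0 < Real.log 2 := Real.log_pos one_lt_two
    have hpos : (0 : ℝ) < ((n + 1 : ℕ) : ℝ) * Real.log 2 := by positivity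
    rw [Real.exp_neg, two_mul, Real.exp_add, Real.exp_log hpos, ← sq, mul_pow, mul_inv]
  have hBC := ae_eventually_notMem (μ := P)
    (s := fun n : ℕ => {ω | ∃ i, r n < |(((2 : ℝ) ^ n) ^ ρ)⁻¹ * X (2 ^ n * denseTime i) ω|}) (by
      refine ne_top_of_le_ne_top (ENNReal.mul_ne_top hK hsummable.tsum_ofReal_lt_top.ne) ?_
      rw [← ENNReal.tsum_mul_left]
      refine ENNReal.tsum_le_tsum fun n => (htail _ (by positivity) _ (hr0 n)).trans ?_
      exact mul_le_mul_right (ENNReal.ofReal_le_ofReal (hexp n)) K)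
  refine ⟨B, ?_⟩
  filter_upwards [hcont, hBC] with ω hω hev
  obtain ⟨N, hN⟩ := eventually_atTop.1 hev
  filter_upwards [eventually_ge_atTop ((2 : ℝ) ^ (N + 2))] with s hs
  obtain ⟨n, hn, hn'⟩ := exists_nat_pow_near
    ((one_le_pow₀ one_le_two).trans hs) (one_lt_two (α := ℝ))
  have hNn : N + 2 < n + 1 := (pow_lt_pow_iff_right₀ one_lt_two).1 (hs.trans_lt hn')
  have hpow : (0 : ℝ) < 2 ^ n := by positivity
  have hs0 : 0 < s := hpow.trans_le hn
  have hpowρ : 0 < ((2 : ℝ) ^ n) ^ ρ := Real.rpow_pos_of_pos hpow ρ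
  have hblock := hN n (by omega)
  simp only [not_exists, not_lt] at hblock
  have hsup := abs_le_of_forall_denseTime
    (f := fun u => (((2 : ℝ) ^ n) ^ ρ)⁻¹ * X (2 ^ n * u) ω)
    (continuousOn_const.mul (hω.comp (by fun_prop) fun u hu =>
      mul_nonneg hpow.le (zero_le_one.trans hu.1))) hblock
    (s := s / 2 ^ n) ⟨(one_le_div hpow).2 hn,
      (div_le_iff₀ hpow).2 (by rw [pow_succ] at hn'; linarith)⟩
  rw [mul_div_cancel₀ _ hpow.ne', abs_mul, abs_of_pos (inv_pos.2 hpowρ),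
    inv_mul_le_iff₀ hpowρ] at hsup
  have hlogpos : 0 < Real.log (2 ^ n) :=
    Real.log_pos (one_lt_pow₀ one_lt_two (by omega))
  have hlog : Real.log (Real.log (2 ^ n)) ≤ Real.log (Real.log s) :=
    Real.log_le_log hlogpos (Real.log_le_log hpow hn)
  rw [sqrt_lil_normalization hs0]
  calc |X s ω| ≤ ((2 : ℝ) ^ n) ^ ρ * (B * Real.sqrt (2 * Real.log (Real.log (2 ^ n)))) := hsup
    _ ≤ s ^ ρ * (B * Real.sqrt (2 * Real.log (Real.log s))) := by gcongr
    _ = B * (s ^ ρ * Real.sqrt (2 * Real.log (Real.log s))) := by ring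

end UpperBound

section LowerBound

variable {Ω : Type*} [MeasurableSpace Ω] {P : Measure Ω} {X : ℝ → Ω → ℝ} {R : ℝ → ℝ → ℝ}

/-- Large increments along `α ^ n` force large values of the normalized path, provided the path is
bounded by a multiple of the normalization. -/
lemma IsCenteredGaussianProcess.frequently_le_normalized
    (hGauss : IsCenteredGaussianProcess P X) {ρ : ℝ} (hρ : 0 < ρ)
    (hR : ∀ s t : ℝ, 0 ≤ s → 0 ≤ t → R s t = ∫ ω, X s ω * X t ω ∂P)
    (hss : ∀ c > (0 : ℝ), ∀ s > (0 : ℝ), ∀ t > (0 : ℝ),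
      R (c * s) (c * t) = c ^ (2 * ρ) * R s t) {α B : ℝ} (hα : 1 < α) (hB : 0 ≤ B) {ω : Ω}
    (hbound : ∀ᶠ s : ℝ in atTop,
      |X s ω| ≤ B * Real.sqrt (2 * s ^ (2 * ρ) * Real.log (Real.log s)))
    (hfreq : ∃ᶠ n : ℕ in atTop,
      Real.sqrt (2 * variance (fun ω' => X (α ^ (n + 1)) ω' - X (α ^ n) ω') P
          * Real.log (Real.log (α ^ (n + 1))))
        < X (α ^ (n + 1)) ω - X (α ^ n) ω) :
    ∃ᶠ s : ℝ in atTop, Real.sqrt (R 1 1) * (1 - (α ^ ρ)⁻¹) - B * (α ^ ρ)⁻¹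
      ≤ X s ω / Real.sqrt (2 * s ^ (2 * ρ) * Real.log (Real.log s)) := by
  have hα0 : 0 < α := one_pos.trans hα
  have hαρ : 1 < α ^ ρ := Real.one_lt_rpow hα hρ
  have hpow : Tendsto (fun n : ℕ => α ^ n) atTop atTop := tendsto_pow_atTop_atTop_of_one_lt hα
  have hlarge : ∀ᶠ n : ℕ in atTop, 1 < Real.log (α ^ n) :=
    (Real.tendsto_log_atTop.comp hpow).eventually_gt_atTop 1
  refine (hpow.comp (tendsto_add_atTop_nat 1)).frequently
    ((hfreq.and_eventually ((hpow.eventually hbound).and hlarge)).mono ?_)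
  rintro n ⟨hinc, hn, hlog⟩
  simp only [Function.comp_apply]
  have ht : 0 < α ^ n := by positivity
  have ht' : 0 < α ^ (n + 1) := by positivity
  rw [sqrt_lil_normalization ht] at hn
  rw [sqrt_lil_normalization ht']
  have hloglog : Real.log (Real.log (α ^ n)) ≤ Real.log (Real.log (α ^ (n + 1))) :=
    Real.log_le_log (one_pos.trans hlog)
      (Real.log_le_log ht (pow_le_pow_right₀ hα.le n.le_succ))
  have hℓ : 0 < Real.log (Real.log (α ^ n)) := Real.log_pos hlog
  have hscale : (α ^ (n + 1)) ^ ρ = α ^ ρ * (α ^ n) ^ ρ := by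
    rw [pow_succ', Real.mul_rpow hα0.le ht.le]
  have hvar := hGauss.le_variance_increment hR hss ht ht'
  set T := (α ^ (n + 1)) ^ ρ
  set S := (α ^ n) ^ ρ
  set ℓ := Real.log (Real.log (α ^ (n + 1)))
  have hℓ' : 0 < ℓ := hℓ.trans_le hloglog
  have hS : 0 < S := Real.rpow_pos_of_pos ht ρ
  have hT : 0 < T := Real.rpow_pos_of_pos ht' ρ
  have hST : S = T * (α ^ ρ)⁻¹ := by rw [hscale]; field_simp
  have hTS : 0 ≤ T - S := by rw [hscale]; nlinarith
  have hg : 0 < Real.sqrt (2 * ℓ) := Real.sqrt_pos.2 (by positivity)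
  have hR0 : 0 ≤ R 1 1 := by
    rw [hR 1 1 zero_le_one zero_le_one]
    exact integral_nonneg fun ω' => mul_self_nonneg _
  have hlower : Real.sqrt (R 1 1) * (T - S) * Real.sqrt (2 * ℓ)
      ≤ X (α ^ (n + 1)) ω - X (α ^ n) ω := by
    refine le_trans ?_ hinc.le
    rw [← Real.sqrt_sq hTS, ← Real.sqrt_mul hR0, ← Real.sqrt_mul (by positivity)]
    refine Real.sqrt_le_sqrt ?_
    nlinarith
  have hprev : -(B * (S * Real.sqrt (2 * ℓ))) ≤ X (α ^ n) ω := by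
    refine le_trans (neg_le_neg ?_) (neg_le_of_abs_le hn)
    gcongr
  rw [le_div_iff₀ (by positivity)]
  calc _ = Real.sqrt (R 1 1) * (T - T * (α ^ ρ)⁻¹) * Real.sqrt (2 * ℓ)
        - B * (T * (α ^ ρ)⁻¹ * Real.sqrt (2 * ℓ)) := by ring
    _ = Real.sqrt (R 1 1) * (T - S) * Real.sqrt (2 * ℓ) - B * (S * Real.sqrt (2 * ℓ)) := by
      rw [← hST]
    _ ≤ X (α ^ (n + 1)) ω := by linarith

end LowerBound

/-- Proposition 2 (lower bound in the LIL): under self-similarity of the kernel with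
exponent `ρ > 0`, if for every sufficiently large `α > 1`, with `t_n = α^n` and
`γ_n = Var(X(t_{n+1}) - X(t_n))`, one has
`P(X(t_{n+1}) - X(t_n) > (2 γ_n log log t_{n+1})^{1/2}  i.o.) = 1`, then almost surely
`limsup_{s→∞} X(s)/√(2 s^{2ρ} log log s) ≥ σ = R(1,1)^{1/2}`. -/
theorem lil_lower_bound {Ω : Type*} [MeasurableSpace Ω] (P : Measure Ω)
    [IsProbabilityMeasure P] (X : ℝ → Ω → ℝ) (R : ℝ → ℝ → ℝ) (ρ : ℝ) (hρ : 0 < ρ)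
    (hGauss : IsCenteredGaussianProcess P X)
    (hcont : ∀ᵐ ω ∂P, ContinuousOn (fun s : ℝ => X s ω) (Set.Ici (0 : ℝ)))
    (hR : ∀ s t : ℝ, 0 ≤ s → 0 ≤ t → R s t = ∫ ω, X s ω * X t ω ∂P)
    (hss : ∀ c > (0 : ℝ), ∀ s > (0 : ℝ), ∀ t > (0 : ℝ),
      R (c * s) (c * t) = c ^ (2 * ρ) * R s t)
    (hsubseq : ∃ α₀ > (1 : ℝ), ∀ α ≥ α₀,
      P {ω | ∃ᶠ n : ℕ in atTop,
          Real.sqrt (2 * variance (fun ω' => X (α ^ (n + 1)) ω' - X (α ^ n) ω') P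
              * Real.log (Real.log (α ^ (n + 1))))
            < X (α ^ (n + 1)) ω - X (α ^ n) ω} = 1) :
    ∀ᵐ ω ∂P,
      Real.sqrt (R 1 1) ≤
        limsup (fun s : ℝ =>
          X s ω / Real.sqrt (2 * s ^ (2 * ρ) * Real.log (Real.log s))) atTop := by
  obtain ⟨α₀, hα₀, hfreq⟩ := hsubseq
  obtain ⟨B, hB⟩ := hGauss.exists_ae_eventually_abs_le hρ hcont hR hss
  have hmeas : ∀ α : ℝ, MeasurableSet {ω | ∃ᶠ n : ℕ in atTop,
      Real.sqrt (2 * variance (fun ω' => X (α ^ (n + 1)) ω' - X (α ^ n) ω') P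
          * Real.log (Real.log (α ^ (n + 1))))
        < X (α ^ (n + 1)) ω - X (α ^ n) ω} := fun α => by
    convert MeasurableSet.measurableSet_limsup fun n : ℕ =>
      measurableSet_lt (measurable_const (a := Real.sqrt
        (2 * variance (fun ω' => X (α ^ (n + 1)) ω' - X (α ^ n) ω') P
          * Real.log (Real.log (α ^ (n + 1))))))
        ((hGauss.1 (α ^ (n + 1))).sub (hGauss.1 (α ^ n))) using 1
    ext ω
    rw [mem_limsup_iff_frequently_mem]
    rfl
  have hae : ∀ᵐ ω ∂P, ∀ k : ℕ, ∃ᶠ n : ℕ in atTop,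
      Real.sqrt (2 * variance (fun ω' => X ((α₀ + k) ^ (n + 1)) ω' - X ((α₀ + k) ^ n) ω') P
          * Real.log (Real.log ((α₀ + k) ^ (n + 1))))
        < X ((α₀ + k) ^ (n + 1)) ω - X ((α₀ + k) ^ n) ω :=
    ae_all_iff.2 fun k => (mem_ae_iff_prob_eq_one (hmeas _)).2 (hfreq _ (by simp))
  filter_upwards [hB, hae] with ω hω hω'
  have hbound : ∀ᶠ s : ℝ in atTop,
      |X s ω| ≤ |B| * Real.sqrt (2 * s ^ (2 * ρ) * Real.log (Real.log s)) := by
    filter_upwards [hω] with s hs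
    exact hs.trans (mul_le_mul_of_nonneg_right (le_abs_self B) (Real.sqrt_nonneg _))
  have hbdd : IsBoundedUnder (· ≤ ·) atTop fun s : ℝ =>
      X s ω / Real.sqrt (2 * s ^ (2 * ρ) * Real.log (Real.log s)) := by
    refine ⟨|B|, eventually_map.2 ?_⟩
    filter_upwards [hbound] with s hs
    exact div_le_of_le_mul₀ (Real.sqrt_nonneg _) (abs_nonneg B) ((le_abs_self _).trans hs)
  have hα : Tendsto (fun k : ℕ => ((α₀ + k) ^ ρ)⁻¹) atTop (𝓝 0) :=
    ((tendsto_rpow_atTop hρ).comp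
      (tendsto_atTop_add_const_left _ α₀ tendsto_natCast_atTop_atTop)).inv_tendsto_atTop
  have hlim : Tendsto (fun k : ℕ => Real.sqrt (R 1 1) * (1 - ((α₀ + k) ^ ρ)⁻¹)
      - |B| * ((α₀ + k) ^ ρ)⁻¹) atTop (𝓝 (Real.sqrt (R 1 1))) := by
    simpa using ((hα.const_sub 1).const_mul (Real.sqrt (R 1 1))).sub (hα.const_mul |B|)
  refine le_of_tendsto' hlim fun k => le_limsup_of_frequently_le ?_ hbdd
  exact hGauss.frequently_le_normalized hρ hR hss
    (hα₀.trans_le (by simp)) (abs_nonneg B) hbound (hω' k)
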